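/- Let 2 < p < 4 and s ∈ [0,1]. Then F_p(s) ≤ 0, where F_p(s) = ((4-p)/2 + ((p-2)/2)·s⁴)·B(2/p, 1 - 2/p) - ∫_0^1 t^{2/p - 1}(1-t)^{-2/p}·(max{s², t²})^{p-2} dt. -/

import Mathlib

open MeasureTheory

/-- The real Beta function, `B(x,y) = ∫_0^1 t^(x-1) (1-t)^(y-1) dt`. -/
noncomputable def realBeta (x y : ℝ) : ℝ :=
  ∫ t in (0:ℝ)..1, t ^ (x - 1) * (1 - t) ^ (y - 1)

lemma ofReal_beta_integrand (x y : ℝ) {t : ℝ} (ht0 : 0 ≤ t) (ht1 : t ≤ 1) :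
    (t : ℂ) ^ ((x : ℂ) - 1) * (1 - (t : ℂ)) ^ ((y : ℂ) - 1)
      = ((t ^ (x - 1) * (1 - t) ^ (y - 1) : ℝ) : ℂ) := by
  rw [Complex.ofReal_mul, Complex.ofReal_cpow ht0, Complex.ofReal_cpow (sub_nonneg.2 ht1)]
  push_cast
  rfl

lemma intervalIntegrable_beta {x y : ℝ} (hx : 0 < x) (hy : 0 < y) :
    IntervalIntegrable (fun t : ℝ => t ^ (x - 1) * (1 - t) ^ (y - 1)) volume 0 1 := by
  have h := Complex.betaIntegral_convergent (u := x) (v := y) (by simpa) (by simpa)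
  rw [intervalIntegrable_iff] at h ⊢
  refine IntegrableOn.congr_fun h.re (fun t ht => ?_) measurableSet_uIoc
  rw [Set.uIoc_of_le zero_le_one] at ht
  simp only [ofReal_beta_integrand x y ht.1.le ht.2]
  exact Complex.ofReal_re _

lemma ofReal_realBeta (x y : ℝ) : (realBeta x y : ℂ) = Complex.betaIntegral x y := by
  rw [realBeta, Complex.betaIntegral, ← intervalIntegral.integral_ofReal]
  refine intervalIntegral.integral_congr fun t ht => ?_
  rw [Set.uIcc_of_le zero_le_one] at ht
  exact (ofReal_beta_integrand x y ht.1 ht.2).symm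

lemma realBeta_eq_beta {x y : ℝ} (hx : 0 < x) (hy : 0 < y) :
    realBeta x y = ProbabilityTheory.beta x y := by
  rw [ProbabilityTheory.beta_eq_betaIntegralReal x y hx hy, ← ofReal_realBeta, Complex.ofReal_re]

lemma realBeta_add_one {x y : ℝ} (hx : 0 < x) (hy : 0 < y) :
    realBeta (x + 1) y = x / (x + y) * realBeta x y := by
  rw [realBeta_eq_beta hx hy, realBeta_eq_beta (by linarith) hy, ProbabilityTheory.beta,
    ProbabilityTheory.beta, add_right_comm, Real.Gamma_add_one hx.ne',
    Real.Gamma_add_one (add_pos hx hy).ne']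
  have := (Real.Gamma_pos_of_pos (add_pos hx hy)).ne'
  have := (add_pos hx hy).ne'
  field_simp

/-- The generalized arcsine weight `t ^ (a - 1) * (1 - t) ^ (-a)`. -/
noncomputable def arcsineWeight (a t : ℝ) : ℝ := t ^ (a - 1) * (1 - t) ^ (-a)

lemma arcsineWeight_nonneg (a : ℝ) {t : ℝ} (ht0 : 0 ≤ t) (ht1 : t ≤ 1) :
    0 ≤ arcsineWeight a t :=
  mul_nonneg (Real.rpow_nonneg ht0 _) (Real.rpow_nonneg (sub_nonneg.2 ht1) _)

lemma intervalIntegrable_arcsineWeight {a : ℝ} (ha0 : 0 < a) (ha1 : a < 1) :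
    IntervalIntegrable (arcsineWeight a) volume 0 1 := by
  convert intervalIntegrable_beta ha0 (sub_pos.2 ha1) using 3
  rw [arcsineWeight]
  ring_nf

lemma intervalIntegrable_arcsineWeight_mul {a : ℝ} (ha0 : 0 < a) (ha1 : a < 1) {f : ℝ → ℝ}
    (hf : Continuous f) :
    IntervalIntegrable (fun t => arcsineWeight a t * f t) volume 0 1 :=
  (intervalIntegrable_arcsineWeight ha0 ha1).mul_continuousOn hf.continuousOn

lemma integral_arcsineWeight (a : ℝ) :
    ∫ t in (0:ℝ)..1, arcsineWeight a t = realBeta a (1 - a) := by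
  rw [realBeta]
  congr 1 with t
  rw [arcsineWeight]
  ring_nf

lemma integral_arcsineWeight_mul_pow (a : ℝ) (k : ℕ) :
    ∫ t in (0:ℝ)..1, arcsineWeight a t * t ^ k = realBeta (a + k) (1 - a) := by
  rw [realBeta]
  refine intervalIntegral.integral_congr_ae (Filter.Eventually.of_forall fun t ht => ?_)
  rw [Set.uIoc_of_le zero_le_one] at ht
  rw [arcsineWeight, show a + k - 1 = (a - 1) + k by ring, Real.rpow_add ht.1, Real.rpow_natCast]
  ring_nf

lemma integral_arcsineWeight_mul_cubic {a : ℝ} (ha0 : 0 < a) (ha1 : a < 1) (c₁ c₂ c₃ : ℝ) :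
    ∫ t in (0:ℝ)..1, arcsineWeight a t * (c₁ * t + c₂ * t ^ 2 + c₃ * t ^ 3)
      = (c₁ * a + c₂ * (a * (a + 1) / 2) + c₃ * (a * (a + 1) * (a + 2) / 6))
        * realBeta a (1 - a) := by
  have hi (k : ℕ) (c : ℝ) :
      IntervalIntegrable (fun t => c * (arcsineWeight a t * t ^ k)) volume 0 1 :=
    (intervalIntegrable_arcsineWeight_mul ha0 ha1 (continuous_pow k)).const_mul c
  have hrw : ∀ t : ℝ, arcsineWeight a t * (c₁ * t + c₂ * t ^ 2 + c₃ * t ^ 3)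
      = c₁ * (arcsineWeight a t * t ^ 1) + c₂ * (arcsineWeight a t * t ^ 2)
        + c₃ * (arcsineWeight a t * t ^ 3) := fun t => by ring
  have h1 := realBeta_add_one ha0 (sub_pos.2 ha1)
  have h2 := realBeta_add_one (x := a + 1) (by linarith) (sub_pos.2 ha1)
  have h3 := realBeta_add_one (x := a + 1 + 1) (by linarith) (sub_pos.2 ha1)
  simp only [hrw]
  rw [intervalIntegral.integral_add ((hi 1 c₁).add (hi 2 c₂)) (hi 3 c₃),
    intervalIntegral.integral_add (hi 1 c₁) (hi 2 c₂)]
  simp only [intervalIntegral.integral_const_mul, integral_arcsineWeight_mul_pow]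
  rw [show a + (3 : ℕ) = a + 1 + 1 + 1 by push_cast; ring,
    show a + (2 : ℕ) = a + 1 + 1 by push_cast; ring, Nat.cast_one, h3, h2, h1,
    show a + (1 - a) = 1 by ring, show a + 1 + (1 - a) = 2 by ring,
    show a + 1 + 1 + (1 - a) = 3 by ring]
  ring

lemma realBeta_pos {x y : ℝ} (hx : 0 < x) (hy : 0 < y) : 0 < realBeta x y :=
  realBeta_eq_beta hx hy ▸ ProbabilityTheory.beta_pos hx hy

lemma le_integral_arcsineWeight_mul_rpow_of_cubic {a q c c₁ c₂ c₃ : ℝ} (ha0 : 0 < a) (ha1 : a < 1)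
    (hq : 0 ≤ q)
    (hpt : ∀ t ∈ Set.Ioc (0:ℝ) 1, c₁ * t + c₂ * t ^ 2 + c₃ * t ^ 3 ≤ t ^ q)
    (hc : c ≤ c₁ * a + c₂ * (a * (a + 1) / 2) + c₃ * (a * (a + 1) * (a + 2) / 6)) :
    c * realBeta a (1 - a) ≤ ∫ t in (0:ℝ)..1, arcsineWeight a t * t ^ q := by
  refine (mul_le_mul_of_nonneg_right hc (realBeta_pos ha0 (sub_pos.2 ha1)).le).trans ?_
  rw [← integral_arcsineWeight_mul_cubic ha0 ha1]
  refine intervalIntegral.integral_mono_on_of_le_Ioo zero_le_one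
    (intervalIntegrable_arcsineWeight_mul ha0 ha1 (by fun_prop))
    (intervalIntegrable_arcsineWeight_mul ha0 ha1 (Real.continuous_rpow_const hq))
    fun t ht => ?_
  exact mul_le_mul_of_nonneg_left (hpt t ⟨ht.1, ht.2.le⟩)
    (arcsineWeight_nonneg a ht.1.le ht.2.le)

/-- With `a = 4 / (q + 4)`, the `q`-th moment of the weight is at least `1 - q / 4`. -/
lemma le_integral_arcsineWeight_mul_rpow {a q : ℝ} (hq0 : 0 < q) (haq : a = 4 / (q + 4)) :
    (1 - q / 4) * realBeta a (1 - a) ≤ ∫ t in (0:ℝ)..1, arcsineWeight a t * t ^ q := by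
  have ha0 : 0 < a := by rw [haq]; positivity
  have ha1 : a < 1 := by rw [haq, div_lt_one (by positivity)]; linarith
  rcases le_total q 1 with h1 | h1
  · refine le_integral_arcsineWeight_mul_rpow_of_cubic (c₁ := 1) (c₂ := 0) (c₃ := 0)
      ha0 ha1 hq0.le (fun t ht => ?_) ?_
    · simpa using Real.rpow_le_rpow_of_exponent_ge ht.1 ht.2 h1
    · simp only [one_mul, zero_mul, add_zero]
      rw [haq, le_div_iff₀ (by positivity)]
      nlinarith
  rcases le_total q 2 with h2 | h2
  · refine le_integral_arcsineWeight_mul_rpow_of_cubic (c₁ := 0) (c₂ := 3 - q) (c₃ := q - 2)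
      ha0 ha1 hq0.le (fun t ht => ?_) ?_
    · have hb := rpow_one_add_le_one_add_mul_self (s := t - 1) (by linarith [ht.1])
        (p := 2 - q) (by linarith) (by linarith)
      have hpos : 0 < t ^ (2 - q) := Real.rpow_pos_of_pos ht.1 _
      have hmul : t ^ q * t ^ (2 - q) = t ^ 2 := by
        rw [← Real.rpow_add ht.1, ← Real.rpow_natCast]
        norm_num
      rw [add_sub_cancel] at hb
      have hkey : (1 + (2 - q) * (1 - t)) * t ^ (2 - q) ≤ 1 := by
        have : 0 ≤ 1 + (2 - q) * (1 - t) := by nlinarith [ht.2]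
        nlinarith [mul_le_mul_of_nonneg_left hb this, sq_nonneg ((2 - q) * (1 - t))]
      have := mul_le_mul_of_nonneg_left hkey (sq_nonneg t)
      refine le_of_mul_le_mul_right ?_ hpos
      linarith
    · have hid : 0 * a + (3 - q) * (a * (a + 1) / 2) + (q - 2) * (a * (a + 1) * (a + 2) / 6)
          = 2 * (q + 8) * (12 + 5 * q - q ^ 2) / (3 * (q + 4) ^ 3) := by
        rw [haq]
        field_simp
        ring
      rw [hid, le_div_iff₀ (by positivity)]
      nlinarith [mul_nonneg hq0.le (sq_nonneg (4 * q - 3)), pow_pos hq0 4]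
  · refine le_integral_arcsineWeight_mul_rpow_of_cubic (c₁ := 2 - q) (c₂ := q - 1) (c₃ := 0)
      ha0 ha1 hq0.le (fun t ht => ?_) ?_
    · have hb := one_add_mul_self_le_rpow_one_add (s := t - 1) (by linarith [ht.1])
        (p := q - 1) (by linarith)
      rw [add_sub_cancel] at hb
      have hmul : t ^ q = t ^ (q - 1) * t := by
        rw [← Real.rpow_add_one ht.1.ne']
        ring_nf
      rw [hmul]
      nlinarith [mul_le_mul_of_nonneg_right hb ht.1.le]
    · have hid : (2 - q) * a + (q - 1) * (a * (a + 1) / 2) + 0 * (a * (a + 1) * (a + 2) / 6)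
          = 2 * (8 + 3 * q - q ^ 2) / (q + 4) ^ 2 := by
        rw [haq]
        field_simp
        ring
      rw [hid, le_div_iff₀ (by positivity)]
      nlinarith [mul_nonneg hq0.le (mul_nonneg hq0.le (sq_nonneg (q - 2))), mul_pos hq0 hq0]

/-- `r log u + b log (1 - u)` cannot be larger on both sides of a point when `b ≥ 0`. -/
lemma min_log_add_log_one_sub_le {r b u v w : ℝ} (hb : 0 ≤ b) (hu : 0 < u) (huv : u < v)
    (hvw : v < w) (hw : w < 1) :
    min (r * Real.log u + b * Real.log (1 - u)) (r * Real.log w + b * Real.log (1 - w))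
      ≤ r * Real.log v + b * Real.log (1 - v) := by
  rcases le_total 0 r with hr | hr
  · have hlog := strictConcaveOn_log_Ioi.concaveOn
    have h1 : ConcaveOn ℝ (Set.Ioo (0:ℝ) 1) fun x => r * Real.log x :=
      (hlog.subset (fun x hx => hx.1) (convex_Ioo 0 1)).smul hr
    have h2 : ConcaveOn ℝ (Set.Ioo (0:ℝ) 1) fun x => b * Real.log (1 - x) := by
      refine ConcaveOn.smul hb ⟨convex_Ioo 0 1, fun x hx y hy m n hm hn hmn => ?_⟩
      have := hlog.2 (x := 1 - x) (sub_pos.2 hx.2) (y := 1 - y) (sub_pos.2 hy.2) hm hn hmn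
      convert this using 2
      simp only [smul_eq_mul]
      linear_combination -hmn
    exact (h1.add h2).min_le_of_mem_Icc ⟨hu, by linarith⟩ ⟨by linarith, hw⟩ ⟨huv.le, hvw.le⟩
  · refine (min_le_right _ _).trans ?_
    have h1 : Real.log v ≤ Real.log w := Real.log_le_log (by linarith) hvw.le
    have h2 : Real.log (1 - w) ≤ Real.log (1 - v) := Real.log_le_log (by linarith) (by linarith)
    nlinarith [mul_le_mul_of_nonneg_left h2 hb, mul_le_mul_of_nonpos_left h1 hr]

lemma continuousAt_arcsineWeight (a : ℝ) {x : ℝ} (hx0 : 0 < x) (hx1 : x < 1) :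
    ContinuousAt (arcsineWeight a) x :=
  (Real.continuousAt_rpow_const x _ (Or.inl hx0.ne')).mul
    ((continuousAt_const.sub continuousAt_id).rpow_const (Or.inl (sub_pos.2 hx1).ne'))

lemma hasDerivAt_integral_arcsineWeight_mul {a x : ℝ} (ha0 : 0 < a) (ha1 : a < 1) {f : ℝ → ℝ}
    (hf : Continuous f) (hx0 : 0 < x) (hx1 : x < 1) :
    HasDerivAt (fun u => ∫ t in (0:ℝ)..u, arcsineWeight a t * f t) (arcsineWeight a x * f x) x := by
  have hi := intervalIntegrable_arcsineWeight_mul ha0 ha1 hf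
  refine intervalIntegral.integral_hasDerivAt_right (hi.mono_set ?_) ?_
    ((continuousAt_arcsineWeight a hx0 hx1).mul hf.continuousAt)
  · rw [Set.uIcc_of_le hx0.le, Set.uIcc_of_le zero_le_one]
    exact Set.Icc_subset_Icc_right hx1.le
  · refine ContinuousOn.stronglyMeasurableAtFilter isOpen_Ioo (fun y hy => ?_) x
      (show x ∈ Set.Ioo (0:ℝ) 1 from ⟨hx0, hx1⟩)
    exact ((continuousAt_arcsineWeight a hy.1 hy.2).mul hf.continuousAt).continuousWithinAt

lemma continuousOn_integral_arcsineWeight_mul {a : ℝ} (ha0 : 0 < a) (ha1 : a < 1) {f : ℝ → ℝ}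
    (hf : Continuous f) :
    ContinuousOn (fun u => ∫ t in (0:ℝ)..u, arcsineWeight a t * f t) (Set.Icc 0 1) := by
  have := intervalIntegral.continuousOn_primitive_interval'
    (intervalIntegrable_arcsineWeight_mul ha0 ha1 hf) Set.left_mem_uIcc
  rwa [Set.uIcc_of_le zero_le_one] at this

lemma exists_deriv_pos_of_lt {f f' : ℝ → ℝ} {x y : ℝ} (hxy : x < y)
    (hc : ContinuousOn f (Set.Icc x y)) (hd : ∀ u ∈ Set.Ioo x y, HasDerivAt f (f' u) u)
    (h : f x < f y) : ∃ u ∈ Set.Ioo x y, 0 < f' u := by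
  obtain ⟨u, hu, he⟩ := exists_hasDerivAt_eq_slope f f' hxy hc hd
  exact ⟨u, hu, he ▸ div_pos (sub_pos.2 h) (sub_pos.2 hxy)⟩

lemma exists_deriv_neg_of_lt {f f' : ℝ → ℝ} {x y : ℝ} (hxy : x < y)
    (hc : ContinuousOn f (Set.Icc x y)) (hd : ∀ u ∈ Set.Ioo x y, HasDerivAt f (f' u) u)
    (h : f y < f x) : ∃ u ∈ Set.Ioo x y, f' u < 0 := by
  obtain ⟨u, hu, he⟩ := exists_hasDerivAt_eq_slope f f' hxy hc hd
  exact ⟨u, hu, he ▸ div_neg_of_neg_of_pos (sub_neg.2 h) (sub_pos.2 hxy)⟩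

lemma log_arcsineWeight (a : ℝ) {u : ℝ} (hu0 : 0 < u) (hu1 : u < 1) :
    Real.log (arcsineWeight a u) = (a - 1) * Real.log u + -a * Real.log (1 - u) := by
  have := sub_pos.2 hu1
  rw [arcsineWeight, Real.log_mul (by positivity) (by positivity), Real.log_rpow hu0,
    Real.log_rpow this]

lemma arcsineWeight_pos (a : ℝ) {u : ℝ} (hu0 : 0 < u) (hu1 : u < 1) : 0 < arcsineWeight a u :=
  mul_pos (Real.rpow_pos_of_pos hu0 _) (Real.rpow_pos_of_pos (sub_pos.2 hu1) _)

/-- The difference `B u ^ m - ∫_0^u ψ` of a power and the distribution function of the weight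
changes sign at most once, from negative to positive. -/
lemma rpow_sub_integral_arcsineWeight_nonneg {a m x y : ℝ} (ha0 : 0 < a) (ha1 : a < 1)
    (hm : 0 < m) (hx : 0 < x) (hxy : x < y) (hy : y < 1)
    (hpos : 0 < realBeta a (1 - a) * x ^ m - ∫ t in (0:ℝ)..x, arcsineWeight a t) :
    0 ≤ realBeta a (1 - a) * y ^ m - ∫ t in (0:ℝ)..y, arcsineWeight a t := by
  set B := realBeta a (1 - a) with hB
  have hBpos : 0 < B := realBeta_pos ha0 (sub_pos.2 ha1)
  set G : ℝ → ℝ := fun u => B * u ^ m - ∫ t in (0:ℝ)..u, arcsineWeight a t with hG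
  set G' : ℝ → ℝ := fun u => B * (m * u ^ (m - 1)) - arcsineWeight a u with hG'
  have hcont : ContinuousOn G (Set.Icc 0 1) := by
    have := continuousOn_integral_arcsineWeight_mul ha0 ha1 (f := fun _ => 1) continuous_const
    simp only [mul_one] at this
    exact (continuous_const.mul (Real.continuous_rpow_const hm.le)).continuousOn.sub this
  have hder : ∀ u, 0 < u → u < 1 → HasDerivAt G (G' u) u := fun u hu0 hu1 => by
    have := hasDerivAt_integral_arcsineWeight_mul ha0 ha1 (f := fun _ => 1) continuous_const hu0 hu1
    simp only [mul_one] at this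
    exact ((Real.hasDerivAt_rpow_const (Or.inl hu0.ne')).const_mul B).sub this
  have hG0 : G 0 = 0 := by simp [hG, Real.zero_rpow hm.ne']
  have hG1 : G 1 = 0 := by simp [hG, integral_arcsineWeight, hB]
  by_contra! hneg
  obtain ⟨u, hu, hu'⟩ := exists_deriv_pos_of_lt hx
    (hcont.mono (Set.Icc_subset_Icc_right (by linarith)))
    (fun u hu => hder u hu.1 (by linarith [hu.2])) (hG0.trans_lt hpos)
  obtain ⟨v, hv, hv'⟩ := exists_deriv_neg_of_lt hxy
    (hcont.mono (Set.Icc_subset_Icc hx.le hy.le))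
    (fun u hu => hder u (by linarith [hu.1]) (by linarith [hu.2])) (hneg.trans hpos)
  obtain ⟨w, hw, hw'⟩ := exists_deriv_pos_of_lt hy
    (hcont.mono (Set.Icc_subset_Icc_left (by linarith)))
    (fun u hu => hder u (by linarith [hu.1]) hu.2) (hneg.trans_eq hG1.symm)
  have hlog : ∀ z, 0 < z → Real.log (B * (m * z ^ (m - 1)))
      = Real.log B + Real.log m + (m - 1) * Real.log z := fun z hz => by
    rw [Real.log_mul (by positivity) (by positivity), Real.log_mul (by positivity) (by positivity),
      Real.log_rpow hz]
    ring
  have hu0 : 0 < u := hu.1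
  have hu1 : u < 1 := by linarith [hu.2]
  have hv0 : 0 < v := by linarith [hv.1]
  have hv1 : v < 1 := by linarith [hv.2]
  have hw0 : 0 < w := by linarith [hw.1]
  have hw1 : w < 1 := hw.2
  have h1 := Real.log_lt_log (arcsineWeight_pos a hu0 hu1) (sub_pos.1 hu')
  have h2 := Real.log_lt_log (by positivity) (sub_neg.1 hv')
  have h3 := Real.log_lt_log (arcsineWeight_pos a hw0 hw1) (sub_pos.1 hw')
  rw [hlog _ hu0, log_arcsineWeight a hu0 hu1] at h1
  rw [hlog _ hv0, log_arcsineWeight a hv0 hv1] at h2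
  rw [hlog _ hw0, log_arcsineWeight a hw0 hw1] at h3
  rcases min_le_iff.1 (min_log_add_log_one_sub_le (r := m - a) ha0.le hu0 (hu.2.trans hv.1)
    (hv.2.trans hw.1) hw1) with h | h <;> linarith

lemma integral_arcsineWeight_mul_max_rpow {a q s : ℝ} (ha0 : 0 < a) (ha1 : a < 1) (hq : 0 ≤ q)
    (hs0 : 0 ≤ s) (hs1 : s ≤ 1) :
    ∫ t in (0:ℝ)..1, arcsineWeight a t * max s t ^ q
      = s ^ q * (∫ t in (0:ℝ)..s, arcsineWeight a t)
        + ((∫ t in (0:ℝ)..1, arcsineWeight a t * t ^ q)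
          - ∫ t in (0:ℝ)..s, arcsineWeight a t * t ^ q) := by
  have hsub0 : Set.uIcc 0 s ⊆ Set.uIcc (0:ℝ) 1 := by
    rw [Set.uIcc_of_le hs0, Set.uIcc_of_le zero_le_one]
    exact Set.Icc_subset_Icc_right hs1
  have hsub1 : Set.uIcc s 1 ⊆ Set.uIcc (0:ℝ) 1 := by
    rw [Set.uIcc_of_le hs1, Set.uIcc_of_le zero_le_one]
    exact Set.Icc_subset_Icc_left hs0
  have hi := intervalIntegrable_arcsineWeight_mul ha0 ha1 (Real.continuous_rpow_const hq)
  have hm := intervalIntegrable_arcsineWeight_mul ha0 ha1 (f := fun t => max s t ^ q)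
    ((continuous_const.max continuous_id).rpow_const fun _ => Or.inr hq)
  rw [← intervalIntegral.integral_add_adjacent_intervals (hm.mono_set hsub0) (hm.mono_set hsub1),
    intervalIntegral.integral_interval_sub_left hi (hi.mono_set hsub0),
    ← intervalIntegral.integral_const_mul]
  congr 1
  · refine intervalIntegral.integral_congr fun t ht => ?_
    rw [Set.uIcc_of_le hs0] at ht
    simp only [max_eq_left ht.2, mul_comm]
  · refine intervalIntegral.integral_congr fun t ht => ?_
    rw [Set.uIcc_of_le hs1] at ht
    simp only [max_eq_right ht.1]

lemma realBeta_mul_le_integral_max_rpow {a q s : ℝ} (ha0 : 0 < a) (ha1 : a < 1) (hq0 : 0 < q)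
    (hq4 : q < 4) (hs0 : 0 ≤ s) (hs1 : s ≤ 1)
    (hmom : (1 - q / 4) * realBeta a (1 - a) ≤ ∫ t in (0:ℝ)..1, arcsineWeight a t * t ^ q) :
    (1 - q / 4 + q / 4 * s ^ 4) * realBeta a (1 - a)
      ≤ ∫ t in (0:ℝ)..1, arcsineWeight a t * max s t ^ q := by
  rw [integral_arcsineWeight_mul_max_rpow ha0 ha1 hq0.le hs0 hs1]
  set B := realBeta a (1 - a) with hB
  set M := ∫ t in (0:ℝ)..1, arcsineWeight a t * t ^ q with hM
  set F : ℝ → ℝ := fun u => (1 - q / 4 + q / 4 * u ^ 4) * B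
    - (u ^ q * (∫ t in (0:ℝ)..u, arcsineWeight a t)
        + (M - ∫ t in (0:ℝ)..u, arcsineWeight a t * t ^ q)) with hF
  set G : ℝ → ℝ := fun u => B * u ^ (4 - q) - ∫ t in (0:ℝ)..u, arcsineWeight a t with hG
  have hcq : Continuous fun t : ℝ => t ^ q := Real.continuous_rpow_const hq0.le
  have hcont : ContinuousOn F (Set.Icc 0 1) := by
    have h1 := continuousOn_integral_arcsineWeight_mul ha0 ha1 (f := fun _ => 1) continuous_const
    simp only [mul_one] at h1
    have h2 := continuousOn_integral_arcsineWeight_mul ha0 ha1 hcq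
    exact ContinuousOn.sub (by fun_prop)
      ((hcq.continuousOn.mul h1).add (continuousOn_const.sub h2))
  have hder : ∀ u, 0 < u → u < 1 → HasDerivAt F (q * u ^ (q - 1) * G u) u := fun u hu0 hu1 => by
    have h1 := hasDerivAt_integral_arcsineWeight_mul ha0 ha1 (f := fun _ => 1) continuous_const
      hu0 hu1
    simp only [mul_one] at h1
    have h2 := hasDerivAt_integral_arcsineWeight_mul ha0 ha1 hcq hu0 hu1
    have h3 : HasDerivAt (fun u : ℝ => u ^ q) (q * u ^ (q - 1)) u :=
      Real.hasDerivAt_rpow_const (Or.inl hu0.ne')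
    have h4 := ((((hasDerivAt_pow 4 u).const_mul (q / 4)).const_add (1 - q / 4)).mul_const B).sub
      ((h3.mul h1).add (h2.const_sub M))
    refine h4.congr_deriv ?_
    have hpow : u ^ (q - 1) * u ^ (4 - q) = u ^ 3 := by
      rw [← Real.rpow_add hu0, ← Real.rpow_natCast]
      norm_num
    simp only [hG]
    norm_num
    linear_combination -(q * B) * hpow
  have hF0 : F 0 ≤ 0 := by
    simp only [hF, Real.zero_rpow hq0.ne', intervalIntegral.integral_same]
    linarith
  have hF1 : F 1 = 0 := by simp [hF, integral_arcsineWeight, hB, hM]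
  suffices F s ≤ 0 by simpa only [hF, sub_nonpos] using this
  by_contra! hpos
  have hs0' : 0 < s := hs0.lt_of_ne fun h => by subst h; linarith
  have hs1' : s < 1 := hs1.lt_of_ne fun h => by subst h; linarith
  obtain ⟨x, hx, hx'⟩ := exists_deriv_pos_of_lt hs0'
    (hcont.mono (Set.Icc_subset_Icc_right hs1))
    (fun u hu => hder u hu.1 (hu.2.trans hs1')) (hF0.trans_lt hpos)
  obtain ⟨y, hy, hy'⟩ := exists_deriv_neg_of_lt hs1'
    (hcont.mono (Set.Icc_subset_Icc_left hs0))
    (fun u hu => hder u (hs0'.trans hu.1) hu.2) (hF1.trans_lt hpos)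
  have hx0 : 0 < x := hx.1
  have hy0 : 0 < y := hs0'.trans hy.1
  have hGx : 0 < G x := pos_of_mul_pos_right hx' (by positivity)
  have hGy := rpow_sub_integral_arcsineWeight_nonneg ha0 ha1 (sub_pos.2 hq4) hx0
    (hx.2.trans hy.1) hy.2 hGx
  exact hy'.not_ge (mul_nonneg (by positivity) hGy)

theorem F_nonpos (p : ℝ) (hp2 : 2 < p) (hp4 : p < 4) (s : ℝ) (hs0 : 0 ≤ s) (hs1 : s ≤ 1) :
    ((4 - p) / 2 + (p - 2) / 2 * s ^ 4) * realBeta (2 / p) (1 - 2 / p)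
      - ∫ t in (0:ℝ)..1, t ^ (2 / p - 1) * (1 - t) ^ (-(2 / p)) * max (s ^ 2) (t ^ 2) ^ (p - 2)
      ≤ 0 := by
  have hp0 : 0 < p := by linarith
  have hmom := le_integral_arcsineWeight_mul_rpow (a := 2 / p) (q := 2 * (p - 2)) (by linarith)
    (by rw [show 2 * (p - 2) + 4 = 2 * p by ring]; field_simp; norm_num)
  have h := realBeta_mul_le_integral_max_rpow (a := 2 / p) (q := 2 * (p - 2)) (by positivity)
    (by rwa [div_lt_one hp0]) (by linarith) (by linarith) hs0 hs1 hmom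
  have hint : ∫ t in (0:ℝ)..1,
        t ^ (2 / p - 1) * (1 - t) ^ (-(2 / p)) * max (s ^ 2) (t ^ 2) ^ (p - 2)
      = ∫ t in (0:ℝ)..1, arcsineWeight (2 / p) t * max s t ^ (2 * (p - 2)) := by
    refine intervalIntegral.integral_congr fun t ht => ?_
    rw [Set.uIcc_of_le zero_le_one] at ht
    have hmax : max (s ^ 2) (t ^ 2) = max s t ^ 2 := by
      rcases le_total s t with hst | hst
      · rw [max_eq_right hst, max_eq_right (pow_le_pow_left₀ hs0 hst 2)]
      · rw [max_eq_left hst, max_eq_left (pow_le_pow_left₀ ht.1 hst 2)]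
    simp only [arcsineWeight]
    rw [hmax, Real.rpow_mul (le_max_of_le_left hs0), Real.rpow_two]
  rw [hint, sub_nonpos]
  convert h using 2
  ring
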